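/- arXiv:1801.08232 — 3 statements merged into one kernel-verified Lean document; each statement's English description precedes it below -/
import Mathlib

section
/- Let $\Omega \subset \mathbb{R}^n$ be open, $u \in C^2(\mathbb{R}^n)$ smooth, $s \in (0,1)$, and suppose $u$ is bounded with the set $U = \{x : u(x) > 0\}$ bounded. Suppose also $\partial U$ is a $C^1$ hypersurface. Let $w(x) = \max\{u(x), 0\}$. Then for every nonnegative test function $\varphi \in C_c^\infty(\mathbb{R}^n)$: $\int_{\mathbb{R}^n} w(x)(-\Delta)^s\varphi(x)\,dx \le \int_{U} \varphi(x)(-\Delta)^s u(x)\,dx$. -/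
open MeasureTheory Metric Real

/-- The truncated quadratic weight is integrable against the fractional kernel. -/
theorem integrable_min_one_sq_div_rpow {E : Type*} [NormedAddCommGroup E] [NormedSpace ℝ E]
    [FiniteDimensional ℝ E] [Nontrivial E] [MeasurableSpace E] [BorelSpace E]
    (μ : Measure E) [μ.IsAddHaarMeasure] {s : ℝ} (hs : s ∈ Set.Ioo (0 : ℝ) 1) :
    Integrable (fun y : E => min 1 (‖y‖ ^ 2) / ‖y‖ ^ ((Module.finrank ℝ E : ℝ) + 2 * s)) μ := by
  obtain ⟨hs0, hs1⟩ := hs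
  obtain ⟨d, hd⟩ : ∃ d, Module.finrank ℝ E = d + 1 :=
    Nat.exists_eq_succ_of_ne_zero Module.finrank_pos.ne'
  refine (integrable_fun_norm_addHaar μ
    (f := fun r : ℝ => min 1 (r ^ 2) / r ^ ((Module.finrank ℝ E : ℝ) + 2 * s))).2 ?_
  rw [hd, ← Set.Ioc_union_Ioi_eq_Ioi (zero_le_one' ℝ), integrableOn_union]
  constructor
  · have h : IntegrableOn (fun r : ℝ => r ^ (1 - 2 * s)) (Set.Ioc 0 1) :=
      (intervalIntegrable_iff_integrableOn_Ioc_of_le zero_le_one).1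
        (intervalIntegral.intervalIntegrable_rpow' (by linarith))
    refine h.congr_fun (fun r hr => ?_) measurableSet_Ioc
    have hr0 : 0 < r := hr.1
    have hmin : min 1 (r ^ 2) = r ^ 2 := min_eq_right (pow_le_one₀ hr0.le hr.2)
    simp only [hmin, smul_eq_mul, Nat.add_sub_cancel]
    rw [← mul_div_assoc, ← pow_add, ← rpow_natCast, ← rpow_sub hr0]
    congr 1
    push_cast
    ring
  · refine (integrableOn_Ioi_rpow_of_lt (a := -1 - 2 * s) (by linarith) one_pos).congr_fun
      (fun r hr => ?_) measurableSet_Ioi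
    have hr1 : 1 < r := hr
    have hr0 : 0 < r := one_pos.trans hr1
    have hmin : min 1 (r ^ 2) = 1 := min_eq_left (one_le_pow₀ hr1.le)
    simp only [hmin, smul_eq_mul, Nat.add_sub_cancel]
    rw [← mul_div_assoc, mul_one, ← rpow_natCast, ← rpow_sub hr0]
    congr 1
    push_cast
    ring

/-- Second differences of a `C²` function are quadratically small, locally uniformly. -/
theorem exists_abs_second_difference_le_sq {E : Type*} [NormedAddCommGroup E] [NormedSpace ℝ E]
    [ProperSpace E] {f : E → ℝ} (hf : ContDiff ℝ 2 f) (R : ℝ) :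
    ∃ C : ℝ, 0 ≤ C ∧ ∀ x ∈ closedBall (0 : E) R, ∀ y, ‖y‖ ≤ 1 →
      |2 * f x - f (x + y) - f (x - y)| ≤ C * ‖y‖ ^ 2 := by
  have hf' : ContDiff ℝ 1 (fderiv ℝ f) := hf.fderiv_right (by norm_num)
  obtain ⟨C, hC⟩ := (isCompact_closedBall (0 : E) (R + 1)).exists_bound_of_continuousOn
    (hf'.continuous_fderiv one_ne_zero).continuousOn
  have hC0 : 0 ≤ max C 0 := le_max_right _ _
  refine ⟨2 * max C 0, by positivity, fun x hx y hy => ?_⟩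
  have hmem : ∀ z : E, ‖z‖ ≤ 1 → x + z ∈ closedBall (0 : E) (R + 1) := fun z hz => by
    rw [mem_closedBall_zero_iff] at hx ⊢
    exact (norm_add_le _ _).trans (add_le_add hx hz)
  have hdf : ∀ z, HasFDerivAt f (fderiv ℝ f z) z := fun z =>
    (hf.differentiable two_ne_zero z).hasFDerivAt
  have hderiv : ∀ z : E, HasFDerivAt (fun z => f (x + z) + f (x - z))
      (fderiv ℝ f (x + z) - fderiv ℝ f (x - z)) z := fun z => by
    have h1 := (hdf (x + z)).comp z ((hasFDerivAt_id z).const_add x)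
    have h2 := (hdf (x - z)).comp z ((hasFDerivAt_id z).const_sub x)
    exact (h1.add h2).congr_fderiv (by ext v; simp [sub_eq_add_neg])
  have hbound : ∀ z ∈ closedBall (0 : E) ‖y‖,
      ‖fderiv ℝ f (x + z) - fderiv ℝ f (x - z)‖ ≤ 2 * max C 0 * ‖y‖ := fun z hz => by
    rw [mem_closedBall_zero_iff] at hz
    have hz1 := hz.trans hy
    have hmem' : x - z ∈ closedBall (0 : E) (R + 1) := by
      rw [sub_eq_add_neg]
      exact hmem (-z) (by rwa [norm_neg])
    have h := (convex_closedBall (0 : E) (R + 1)).norm_image_sub_le_of_norm_fderiv_le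
      (f := fderiv ℝ f) (𝕜 := ℝ) (fun p _ => hf'.differentiable one_ne_zero p)
      (fun p hp => (hC p hp).trans (le_max_left C 0))
      hmem' (hmem z hz1)
    refine h.trans ?_
    have h2 : ‖x + z - (x - z)‖ ≤ 2 * ‖y‖ := by
      rw [show x + z - (x - z) = z + z by abel]
      linarith [norm_add_le z z]
    nlinarith
  have h := (convex_closedBall (0 : E) ‖y‖).norm_image_sub_le_of_norm_hasFDerivWithin_le
    (fun z _ => (hderiv z).hasFDerivWithinAt) hbound
    (mem_closedBall_self (norm_nonneg y)) (mem_closedBall_zero_iff.2 le_rfl)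
  simp only [Real.norm_eq_abs, add_zero, sub_zero] at h
  rw [← abs_neg] at h
  convert h using 1
  · congr 1
    ring
  · ring

theorem exists_abs_second_difference_le_min {E : Type*} [NormedAddCommGroup E] [NormedSpace ℝ E]
    [ProperSpace E] {f : E → ℝ} (hf : ContDiff ℝ 2 f) (hfb : ∃ B : ℝ, ∀ x, |f x| ≤ B) (R : ℝ) :
    ∃ C : ℝ, 0 ≤ C ∧ ∀ x ∈ closedBall (0 : E) R, ∀ y,
      |2 * f x - f (x + y) - f (x - y)| ≤ C * min 1 (‖y‖ ^ 2) := by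
  obtain ⟨B, hB⟩ := hfb
  obtain ⟨C, hC0, hC⟩ := exists_abs_second_difference_le_sq hf R
  refine ⟨max C (4 * B), hC0.trans (le_max_left _ _), fun x hx y => ?_⟩
  rcases le_total ‖y‖ 1 with hy | hy
  · rw [min_eq_right (pow_le_one₀ (norm_nonneg y) hy)]
    exact (hC x hx y hy).trans (by gcongr; exact le_max_left _ _)
  · rw [min_eq_left (one_le_pow₀ hy), mul_one]
    refine le_trans ?_ (le_max_right _ _)
    have h1 := abs_le.1 (hB x)
    have h2 := abs_le.1 (hB (x + y))
    have h3 := abs_le.1 (hB (x - y))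
    exact abs_le.2 ⟨by linarith, by linarith⟩

/-- Absolute convergence of the double integral pairing a bounded, boundedly supported function
with the fractional Laplacian of a bounded `C²` function. -/
theorem integrable_prod_mul_second_difference {E : Type*} [NormedAddCommGroup E]
    [NormedSpace ℝ E] [FiniteDimensional ℝ E] [Nontrivial E] [MeasurableSpace E] [BorelSpace E]
    (μ : Measure E) [μ.IsAddHaarMeasure] {s : ℝ} (hs : s ∈ Set.Ioo (0 : ℝ) 1)
    {f g : E → ℝ} (hf : ContDiff ℝ 2 f) (hfb : ∃ B : ℝ, ∀ x, |f x| ≤ B)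
    (hg : Measurable g) (hgb : ∃ M : ℝ, ∀ x, |g x| ≤ M)
    (hgs : Bornology.IsBounded (Function.support g)) :
    Integrable (fun p : E × E => g p.1 * ((2 * f p.1 - f (p.1 + p.2) - f (p.1 - p.2)) /
      ‖p.2‖ ^ ((Module.finrank ℝ E : ℝ) + 2 * s))) (μ.prod μ) := by
  obtain ⟨M, hM⟩ := hgb
  obtain ⟨R, hR⟩ := hgs.subset_closedBall (0 : E)
  obtain ⟨C, hC0, hC⟩ := exists_abs_second_difference_le_min hf hfb R
  have hM0 : 0 ≤ M := (abs_nonneg _).trans (hM 0)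
  have hind : Integrable ((closedBall (0 : E) R).indicator fun _ => M * C) μ :=
    (integrable_indicator_iff measurableSet_closedBall).2
      (integrableOn_const (isCompact_closedBall (0 : E) R).measure_lt_top.ne)
  have hfm : Measurable f := hf.continuous.measurable
  refine (hind.mul_prod (integrable_min_one_sq_div_rpow μ hs)).mono'
    (Measurable.aestronglyMeasurable (by fun_prop)) (Filter.Eventually.of_forall fun p => ?_)
  by_cases hp : p.1 ∈ closedBall (0 : E) R
  · rw [Set.indicator_of_mem hp, norm_mul, norm_div, Real.norm_eq_abs, Real.norm_eq_abs,
      Real.norm_of_nonneg (rpow_nonneg (norm_nonneg _) _)]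
    refine (mul_le_mul (hM _) (div_le_div_of_nonneg_right (hC _ hp _)
      (rpow_nonneg (norm_nonneg _) _)) (by positivity) hM0).trans_eq ?_
    ring
  · have h0 : g p.1 = 0 := by
      by_contra h
      exact hp (hR h)
    simp [h0, Set.indicator_of_notMem hp]

/-- Discrete Kato inequality: pairing with the second difference in a fixed direction. -/
theorem integral_posPart_mul_second_difference_le {E : Type*} [NormedAddCommGroup E]
    [NormedSpace ℝ E] [MeasurableSpace E] [BorelSpace E] (μ : Measure E)
    [IsFiniteMeasureOnCompacts μ] [μ.IsAddRightInvariant] {u φ : E → ℝ} (hu : Continuous u)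
    (hφ : Continuous φ) (hφs : HasCompactSupport φ) (hφ0 : ∀ x, 0 ≤ φ x) (y : E)
    (hw : HasCompactSupport fun x => max (u x) 0) :
    ∫ x, max (u x) 0 * (2 * φ x - φ (x + y) - φ (x - y)) ∂μ ≤
      ∫ x, {x | 0 < u x}.indicator φ x * (2 * u x - u (x + y) - u (x - y)) ∂μ := by
  set w : E → ℝ := fun x => max (u x) 0 with hwdef
  have hwc : Continuous w := hu.max continuous_const
  have hint : ∀ {g : E → ℝ}, Continuous g → Integrable (fun x => w x * g x) μ := fun hg =>
    (hwc.mul hg).integrable_of_hasCompactSupport hw.mul_right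
  have hint' : ∀ {g : E → ℝ}, Continuous g → Integrable (fun x => φ x * g x) μ := fun hg =>
    (hφ.mul hg).integrable_of_hasCompactSupport hφs.mul_right
  have hadd : ∫ x, w x * φ (x + y) ∂μ = ∫ x, φ x * w (x - y) ∂μ := by
    rw [← integral_add_right_eq_self (fun x => φ x * w (x - y)) y]
    simp [mul_comm]
  have hsub : ∫ x, w x * φ (x - y) ∂μ = ∫ x, φ x * w (x + y) ∂μ := by
    rw [← integral_sub_right_eq_self (fun x => φ x * w (x + y)) y]
    simp [mul_comm]
  have hmove : ∫ x, w x * (2 * φ x - φ (x + y) - φ (x - y)) ∂μ =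
      ∫ x, φ x * (2 * w x - w (x + y) - w (x - y)) ∂μ := by
    simp only [mul_sub]
    rw [integral_sub, integral_sub, integral_sub, integral_sub, hadd, hsub, sub_right_comm]
    · rw [show (fun x => w x * (2 * φ x)) = fun x => φ x * (2 * w x) from funext fun x => by ring]
    all_goals first
      | exact hint (by fun_prop)
      | exact hint' (by fun_prop)
      | exact (hint (by fun_prop)).sub (hint (by fun_prop))
      | exact (hint' (by fun_prop)).sub (hint' (by fun_prop))
  rw [hmove]
  refine integral_mono (hint' (by fun_prop)) ?_ fun x => ?_
  · have hUm : MeasurableSet {x | 0 < u x} := (isOpen_lt continuous_const hu).measurableSet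
    refine ((hint' (g := fun x => 2 * u x - u (x + y) - u (x - y)) (by fun_prop)).indicator
      hUm).congr (.of_forall fun x => ?_)
    exact Set.indicator_mul_left _ φ _
  · have h1 : u (x + y) ≤ w (x + y) := le_max_left _ _
    have h2 : u (x - y) ≤ w (x - y) := le_max_left _ _
    have h3 : 0 ≤ w (x + y) := le_max_right _ _
    have h4 : 0 ≤ w (x - y) := le_max_right _ _
    by_cases hx : 0 < u x
    · have hwx : w x = u x := max_eq_left hx.le
      simp only [Set.indicator_of_mem (show x ∈ {x | 0 < u x} from hx), hwx]
      exact mul_le_mul_of_nonneg_left (by linarith) (hφ0 x)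
    · have hwx : w x = 0 := max_eq_right (not_lt.1 hx)
      simp only [Set.indicator_of_notMem (show x ∉ {x | 0 < u x} from hx), hwx, zero_mul]
      exact mul_nonpos_of_nonneg_of_nonpos (hφ0 x) (by linarith)


/-- Kato-type inequality for the fractional Laplacian: if `u ∈ C²` is bounded, the set
`U = {u > 0}` is bounded with `C¹` boundary, and `w = u⁺`, then for every nonnegative test
function `φ`, `∫ w (-Δ)^s φ ≤ ∫_U φ (-Δ)^s u`. The fractional Laplacian is written via the
symmetric second-difference formula. -/
theorem fracLap_positive_part_inequality
    (n : ℕ) (hn : 1 ≤ n) (s : ℝ) (hs : s ∈ Set.Ioo (0:ℝ) 1)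
    (Cns : ℝ) (hCns : 0 < Cns)
    (u : EuclideanSpace ℝ (Fin n) → ℝ)
    (hu : ContDiff ℝ 2 u) (hub : ∃ B : ℝ, ∀ x, |u x| ≤ B)
    (hU : Bornology.IsBounded {x : EuclideanSpace ℝ (Fin n) | 0 < u x})
    (hUbdry : ∀ x ∈ frontier {x : EuclideanSpace ℝ (Fin n) | 0 < u x},
      ∃ f : EuclideanSpace ℝ (Fin n) → ℝ, ContDiff ℝ 1 f ∧ fderiv ℝ f x ≠ 0 ∧
        ∃ ε : ℝ, 0 < ε ∧ ∀ y ∈ ball x ε, (0 < u y ↔ f y < 0)) :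
    ∀ φ : EuclideanSpace ℝ (Fin n) → ℝ,
      ContDiff ℝ (⊤ : ℕ∞) φ → HasCompactSupport φ → (∀ x, 0 ≤ φ x) →
      (∫ x, max (u x) 0 *
          ((Cns / 2) * ∫ y, (2 * φ x - φ (x + y) - φ (x - y)) / ‖y‖ ^ ((n:ℝ) + 2*s)))
        ≤ ∫ x in {x : EuclideanSpace ℝ (Fin n) | 0 < u x},
            φ x * ((Cns / 2) * ∫ y, (2 * u x - u (x + y) - u (x - y)) / ‖y‖ ^ ((n:ℝ) + 2*s)) := by
  intro φ hφ hφs hφ0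
  have : Nonempty (Fin n) := ⟨⟨0, hn⟩⟩
  have hUm : MeasurableSet {x | 0 < u x} :=
    (isOpen_lt continuous_const hu.continuous).measurableSet
  have hwU : Function.support (fun x => max (u x) 0) ⊆ {x | 0 < u x} := fun x hx => by
    by_contra h
    exact hx (max_eq_right (not_lt.1 h))
  have hφb : ∃ B : ℝ, ∀ x, |φ x| ≤ B := hφs.exists_bound_of_continuous hφ.continuous
  have hwb : ∃ M : ℝ, ∀ x, |max (u x) 0| ≤ M := hub.imp fun B hB x => by
    rw [abs_of_nonneg (le_max_right _ _)]
    exact max_le ((le_abs_self _).trans (hB x)) ((abs_nonneg _).trans (hB x))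
  have hφUb : ∃ M : ℝ, ∀ x, |{x | 0 < u x}.indicator φ x| ≤ M := hφb.imp fun B hB x =>
    (norm_indicator_le_norm_self φ x).trans (hB x)
  have hI := integrable_prod_mul_second_difference volume hs (by exact_mod_cast contDiff_infty.1 hφ 2)
    hφb (hu.continuous.max continuous_const).measurable hwb (hU.subset hwU)
  have hJ := integrable_prod_mul_second_difference volume hs hu hub
    (hφ.continuous.measurable.indicator hUm) hφUb (hU.subset Set.support_indicator_subset)
  rw [finrank_euclideanSpace_fin] at hI hJ
  rw [← integral_indicator hUm]
  rw [funext fun x => Set.indicator_mul_left (i := x) {x | 0 < u x} φ _]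
  simp only [mul_left_comm _ (Cns / 2), integral_const_mul]
  refine mul_le_mul_of_nonneg_left ?_ (by positivity)
  simp only [← integral_const_mul]
  refine (integral_integral_swap hI).trans_le (le_trans ?_ (integral_integral_swap hJ).ge)
  refine integral_mono hI.integral_prod_right hJ.integral_prod_right fun y => ?_
  simp only [← mul_div_assoc, integral_div]
  refine div_le_div_of_nonneg_right ?_ (rpow_nonneg (norm_nonneg y) _)
  exact integral_posPart_mul_second_difference_le volume hu.continuous hφ.continuous hφs hφ0 y
    (HasCompactSupport.intro' hU.isCompact_closure isClosed_closure fun x hx =>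
      Function.notMem_support.1 fun h => hx (subset_closure (hwU h)))
end

section
/- Let $\Omega \subset \mathbb{R}^n$ be open and $u, v, f, g \in C^2(\Omega)$ satisfy pointwise in $\Omega$: $-\Delta u + \vec{b}\cdot\nabla u + c\,u = f$ and $-\Delta v + \vec{b}\cdot\nabla v + c\,v = g$, where $\vec{b} \in C^1(\Omega;\mathbb{R}^n)$ and $c \in L^\infty(\Omega)$. Then $w = \max\{u, v\}$ satisfies, in the sense of distributions on $\Omega$: $-\Delta w + \vec{b}\cdot\nabla w + c\,w \le f\,\chi_{\{u>v\}} + g\,\chi_{\{u\le v\}}$, i.e. for every nonnegative $\varphi \in C_c^\infty(\Omega)$, $\int_\Omega w\,(-\Delta\varphi - \mathrm{div}(\vec{b}\varphi) + c\varphi)\,dx \le \int_\Omega \varphi\,(f\chi_{u>v} + g\chi_{u\le v})\,dx$. -/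
open MeasureTheory Metric Real
open scoped RealInnerProductSpace

theorem ContinuousOn.integrableOn_of_eq_zero_off_compact {E : Type*}
    [NormedAddCommGroup E] [MeasurableSpace E] [BorelSpace E] {μ : Measure E}
    [IsFiniteMeasureOnCompacts μ] {Ω K : Set E} {h : E → ℝ}
    (hK : IsCompact K) (hKΩ : K ⊆ Ω) (hΩ : IsOpen Ω) (hc : ContinuousOn h Ω)
    (h0 : ∀ x, x ∉ K → h x = 0) : IntegrableOn h Ω μ :=
  ((hc.mono hKΩ).integrableOn_compact hK).of_forall_sdiff_eq_zero hΩ.measurableSet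
    fun x hx => h0 x hx.2

section IntegrationByParts

variable {E : Type*} [NormedAddCommGroup E] [NormedSpace ℝ E]

/-- A function differentiable on an open set containing its topological support is differentiable
everywhere. -/
theorem DifferentiableOn.differentiable_of_tsupport_subset {Ω : Set E} (hΩ : IsOpen Ω) {ψ : E → ℝ}
    (hψ : DifferentiableOn ℝ ψ Ω) (hs : tsupport ψ ⊆ Ω) : Differentiable ℝ ψ := by
  intro x
  by_cases hx : x ∈ tsupport ψ
  · exact hψ.differentiableAt (hΩ.mem_nhds (hs hx))
  · exact ((differentiableAt_const (0 : ℝ)).congr_of_eventuallyEq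
      (notMem_tsupport_iff_eventuallyEq.mp hx))

theorem ContDiffOn.fderiv_apply_const {Ω : Set E} (hΩ : IsOpen Ω) {W : E → ℝ}
    (hW : ContDiffOn ℝ 2 W Ω) (e : E) : ContDiffOn ℝ 1 (fun z => fderiv ℝ W z e) Ω :=
  (hW.fderiv_of_isOpen hΩ (by norm_num)).clm_apply contDiffOn_const

variable [MeasurableSpace E] [BorelSpace E] [FiniteDimensional ℝ E] {μ : Measure E}
  [μ.IsAddHaarMeasure]

theorem setIntegral_mul_fderiv_eq_neg {Ω : Set E} (hΩ : IsOpen Ω) {W ψ : E → ℝ}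
    (hW : ContDiffOn ℝ 1 W Ω) (hψ : ContDiffOn ℝ 1 ψ Ω) (hc : HasCompactSupport ψ)
    (hs : tsupport ψ ⊆ Ω) (e : E) :
    ∫ x in Ω, W x * fderiv ℝ ψ x e ∂μ = -∫ x in Ω, fderiv ℝ W x e * ψ x ∂μ := by
  have z : ∀ x, x ∉ tsupport ψ → ψ x = 0 := fun x hx => image_eq_zero_of_notMem_tsupport hx
  have z' : ∀ x, x ∉ tsupport ψ → fderiv ℝ ψ x = 0 := fun x hx =>
    fderiv_of_notMem_tsupport ℝ hx
  have hW' := hW.continuousOn_fderiv_of_isOpen hΩ le_rfl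
  have hψ' := hψ.continuousOn_fderiv_of_isOpen hΩ le_rfl
  have key : ∀ h : E → ℝ, ContinuousOn h Ω → (∀ x, x ∉ tsupport ψ → h x = 0) →
      Integrable h μ := fun h hh h0 =>
    (integrableOn_iff_integrable_of_support_subset
      (fun x hx => hs (by by_contra hn; exact hx (h0 x hn)))).mp
      (hh.integrableOn_of_eq_zero_off_compact hc hs hΩ h0)
  rw [setIntegral_eq_integral_of_forall_compl_eq_zero
      (fun x hx => by simp [z' x fun h => hx (hs h)]),
    setIntegral_eq_integral_of_forall_compl_eq_zero
      (fun x hx => by simp [z x fun h => hx (hs h)])]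
  refine integral_mul_fderiv_eq_neg_fderiv_mul_of_integrable ?_ ?_ ?_ ?_ ?_
  · exact key _ ((hW'.clm_apply continuousOn_const).mul hψ.continuousOn)
      fun x hx => by simp [z x hx]
  · exact key _ (hW.continuousOn.mul (hψ'.clm_apply continuousOn_const))
      fun x hx => by simp [z' x hx]
  · exact key _ (hW.continuousOn.mul hψ.continuousOn) fun x hx => by simp [z x hx]
  · exact fun x hx => (hW.differentiableOn one_ne_zero).differentiableAt (hΩ.mem_nhds (hs hx))
  · exact fun x _ => (hψ.differentiableOn one_ne_zero).differentiable_of_tsupport_subset hΩ hs x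

theorem setIntegral_mul_fderiv_fderiv_eq {Ω : Set E} (hΩ : IsOpen Ω) {W φ : E → ℝ}
    (hW : ContDiffOn ℝ 2 W Ω) (hφ : ContDiffOn ℝ 2 φ Ω) (hc : HasCompactSupport φ)
    (hs : tsupport φ ⊆ Ω) (e : E) :
    ∫ x in Ω, W x * fderiv ℝ (fun z => fderiv ℝ φ z e) x e ∂μ =
      ∫ x in Ω, fderiv ℝ (fun z => fderiv ℝ W z e) x e * φ x ∂μ := by
  rw [setIntegral_mul_fderiv_eq_neg hΩ (hW.of_le (by norm_num)) (hφ.fderiv_apply_const hΩ e)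
    (hc.fderiv_apply ℝ e) ((tsupport_fderiv_apply_subset ℝ e).trans hs),
    setIntegral_mul_fderiv_eq_neg hΩ (hW.fderiv_apply_const hΩ e) (hφ.of_le (by norm_num)) hc hs,
    neg_neg]

end IntegrationByParts

section SmoothMax

/-- A smooth convex approximation of the positive part, whose derivative tends to the indicator
of the open half line. -/
noncomputable def smoothPosPart (k t : ℝ) : ℝ := log (1 + exp (k ^ 2 * t - k)) / k ^ 2

theorem contDiff_smoothPosPart (k : ℝ) {m : WithTop ℕ∞} : ContDiff ℝ m (smoothPosPart k) := by
  unfold smoothPosPart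
  refine ContDiff.div_const (ContDiff.log ?_ fun t => by positivity) _
  fun_prop

theorem hasDerivAt_smoothPosPart {k : ℝ} (hk : 1 ≤ k) (t : ℝ) :
    HasDerivAt (smoothPosPart k) (sigmoid (k ^ 2 * t - k)) t := by
  have h : HasDerivAt (fun t => k ^ 2 * t - k) (k ^ 2) t := by
    simpa using ((hasDerivAt_id t).const_mul (k ^ 2)).sub_const k
  have := ((h.exp.const_add 1).log (by positivity)).div_const (k ^ 2)
  refine this.congr_deriv ?_
  rw [sigmoid_def, exp_neg]
  have := exp_pos (k ^ 2 * t - k)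
  field_simp
  ring

theorem hasDerivAt_sigmoid_rescaled (k t : ℝ) :
    HasDerivAt (fun t => sigmoid (k ^ 2 * t - k))
      (sigmoid (k ^ 2 * t - k) * (1 - sigmoid (k ^ 2 * t - k)) * k ^ 2) t := by
  have h : HasDerivAt (fun t => k ^ 2 * t - k) (k ^ 2) t := by
    simpa using ((hasDerivAt_id t).const_mul (k ^ 2)).sub_const k
  exact (hasDerivAt_sigmoid _).comp t h

theorem abs_smoothPosPart_sub_max_le {k : ℝ} (hk : 1 ≤ k) (t : ℝ) :
    |smoothPosPart k t - max t 0| ≤ 1 / k := by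
  have hk0 : 0 < k := by linarith
  set x := k ^ 2 * t - k with hx
  have h0 := exp_pos x
  have hl : max x 0 ≤ log (1 + exp x) := by
    apply max_le
    · rw [le_log_iff_exp_le (by positivity)]; linarith
    · exact log_nonneg (by linarith)
  have hr : log (1 + exp x) ≤ max x 0 + 1 := by
    rw [log_le_iff_le_exp (by positivity), exp_add]
    have h1 : exp x ≤ exp (max x 0) := exp_le_exp.mpr (le_max_left _ _)
    have h2 : 1 ≤ exp (max x 0) := one_le_exp (le_max_right _ _)
    nlinarith [exp_one_gt_d9]
  have e : smoothPosPart k t - max t 0 = (log (1 + exp x) - k ^ 2 * max t 0) / k ^ 2 := by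
    rw [smoothPosPart, ← hx, sub_div, mul_div_cancel_left₀ _ (by positivity)]
  rw [e, abs_div, abs_of_pos (a := k ^ 2) (by positivity), div_le_div_iff₀ (by positivity) hk0]
  suffices |log (1 + exp x) - k ^ 2 * max t 0| ≤ k by nlinarith
  have hm : k ^ 2 * max t 0 = max (x + k) 0 := by
    rw [mul_max_of_nonneg _ _ (by positivity)]; simp [hx]
  rw [hm, abs_le]
  constructor
  · have : max (x + k) 0 ≤ max x 0 + k :=
      max_le (by linarith [le_max_left x 0]) (by linarith [le_max_right x 0])
    linarith
  · rcases le_total x 0 with h | h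
    · rw [max_eq_right h] at hr; linarith [le_max_right (x + k) 0]
    · rw [max_eq_left h] at hr; linarith [le_max_left (x + k) 0]

theorem tendsto_smoothPosPart (t : ℝ) :
    Filter.Tendsto (fun k : ℝ => smoothPosPart k t) Filter.atTop (nhds (max t 0)) := by
  rw [tendsto_iff_norm_sub_tendsto_zero]
  refine squeeze_zero' (.of_forall fun _ => norm_nonneg _)
    ((Filter.eventually_ge_atTop 1).mono fun k hk => abs_smoothPosPart_sub_max_le hk t) ?_
  exact tendsto_const_nhds.div_atTop Filter.tendsto_id

theorem tendsto_sigmoid_rescaled (t : ℝ) :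
    Filter.Tendsto (fun k : ℝ => sigmoid (k ^ 2 * t - k)) Filter.atTop
      (nhds (if 0 < t then 1 else 0)) := by
  split_ifs with h
  · refine tendsto_sigmoid_atTop.comp ?_
    have : Filter.Tendsto (fun k : ℝ => k * (k * t - 1)) Filter.atTop Filter.atTop :=
      Filter.tendsto_id.atTop_mul_atTop₀
        (Filter.tendsto_atTop_add_const_right _ _ (Filter.tendsto_id.atTop_mul_const h))
    exact this.congr fun k => by ring
  · refine tendsto_sigmoid_atBot.comp ?_
    refine Filter.tendsto_atBot_mono (fun k => ?_) Filter.tendsto_neg_atTop_atBot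
    nlinarith [sq_nonneg k]

variable {E : Type*} [NormedAddCommGroup E] [NormedSpace ℝ E]

/-- First derivatives of the regularised maximum of two functions. -/
theorem fderiv_add_smoothPosPart_sub {k : ℝ} (hk : 1 ≤ k) {u v : E → ℝ} {x : E}
    (hu : DifferentiableAt ℝ u x) (hv : DifferentiableAt ℝ v x) :
    fderiv ℝ (fun z => v z + smoothPosPart k (u z - v z)) x =
      fderiv ℝ v x + sigmoid (k ^ 2 * (u x - v x) - k) • (fderiv ℝ u x - fderiv ℝ v x) :=
  (hv.hasFDerivAt.add ((hasDerivAt_smoothPosPart hk _).comp_hasFDerivAt x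
    (hu.hasFDerivAt.sub hv.hasFDerivAt))).fderiv

/-- Convexity bounds the pure second derivatives of the regularised maximum from below. -/
theorem le_fderiv_fderiv_add_smoothPosPart_sub {k : ℝ} (hk : 1 ≤ k) {Ω : Set E} (hΩ : IsOpen Ω)
    {u v : E → ℝ} (hu : ContDiffOn ℝ 2 u Ω) (hv : ContDiffOn ℝ 2 v Ω) {x : E} (hx : x ∈ Ω)
    (e : E) :
    fderiv ℝ (fun z => fderiv ℝ v z e) x e + sigmoid (k ^ 2 * (u x - v x) - k) *
        (fderiv ℝ (fun z => fderiv ℝ u z e) x e - fderiv ℝ (fun z => fderiv ℝ v z e) x e) ≤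
      fderiv ℝ (fun z => fderiv ℝ (fun y => v y + smoothPosPart k (u y - v y)) z e) x e := by
  have hd : ∀ {w : E → ℝ}, ContDiffOn ℝ 2 w Ω → ∀ z ∈ Ω, DifferentiableAt ℝ w z :=
    fun hw z hz => (hw.differentiableOn two_ne_zero).differentiableAt (hΩ.mem_nhds hz)
  have hd' : ∀ {w : E → ℝ}, ContDiffOn ℝ 2 w Ω →
      DifferentiableAt ℝ (fun z => fderiv ℝ w z e) x := fun hw =>
    (((hw.fderiv_of_isOpen hΩ (m := 1) (by norm_num)).clm_apply
      contDiffOn_const).differentiableOn one_ne_zero).differentiableAt (hΩ.mem_nhds hx)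
  have heq : (fun z => fderiv ℝ (fun y => v y + smoothPosPart k (u y - v y)) z e) =ᶠ[nhds x]
      fun z => fderiv ℝ v z e +
        sigmoid (k ^ 2 * (u z - v z) - k) * (fderiv ℝ u z e - fderiv ℝ v z e) := by
    filter_upwards [hΩ.mem_nhds hx] with z hz
    rw [fderiv_add_smoothPosPart_sub hk (hd hu z hz) (hd hv z hz)]
    simp
  have hder := (hd' hv).hasFDerivAt.add
    (((hasDerivAt_sigmoid_rescaled k (u x - v x)).comp_hasFDerivAt x
      ((hd hu x hx).hasFDerivAt.sub (hd hv x hx).hasFDerivAt)).mul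
      ((hd' hu).hasFDerivAt.sub (hd' hv).hasFDerivAt))
  refine le_of_le_of_eq ?_ (congrArg (· e) (heq.fderiv_eq.trans hder.fderiv)).symm
  have h1 := sigmoid_nonneg (k ^ 2 * (u x - v x) - k)
  have h2 := sigmoid_le_one (k ^ 2 * (u x - v x) - k)
  have h3 : 0 ≤ (fderiv ℝ u x e - fderiv ℝ v x e) * (sigmoid (k ^ 2 * (u x - v x) - k) *
      (1 - sigmoid (k ^ 2 * (u x - v x) - k)) * k ^ 2 *
      (fderiv ℝ u x e - fderiv ℝ v x e)) := by
    have : 0 ≤ sigmoid (k ^ 2 * (u x - v x) - k) *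
      (1 - sigmoid (k ^ 2 * (u x - v x) - k)) * k ^ 2 * (fderiv ℝ u x e - fderiv ℝ v x e) ^ 2 :=
      mul_nonneg (mul_nonneg (mul_nonneg h1 (by linarith)) (sq_nonneg _)) (sq_nonneg _)
    linarith
  simp [smul_eq_mul] at h3 ⊢
  linarith

end SmoothMax

section Operator

variable {n : ℕ} {Ω : Set (EuclideanSpace ℝ (Fin n))}
  {b : EuclideanSpace ℝ (Fin n) → EuclideanSpace ℝ (Fin n)} {c φ : EuclideanSpace ℝ (Fin n) → ℝ}

theorem inner_gradient_eq_sum (y : EuclideanSpace ℝ (Fin n)) (W : EuclideanSpace ℝ (Fin n) → ℝ)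
    (x : EuclideanSpace ℝ (Fin n)) :
    ⟪y, gradient W x⟫ = ∑ i, y i * fderiv ℝ W x (EuclideanSpace.single i 1) := by
  rw [inner_gradient_right]
  conv_lhs => rw [← (EuclideanSpace.basisFun (Fin n) ℝ).sum_repr y]
  simp

theorem ContDiffOn.continuousOn_laplacian_sum (hΩ : IsOpen Ω)
    {W : EuclideanSpace ℝ (Fin n) → ℝ} (hW : ContDiffOn ℝ 2 W Ω) :
    ContinuousOn (fun x => ∑ i, fderiv ℝ (fun z => fderiv ℝ W z (EuclideanSpace.single i 1)) x
      (EuclideanSpace.single i 1)) Ω :=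
  continuousOn_finsetSum _ fun _ _ =>
    ((hW.fderiv_apply_const hΩ _).continuousOn_fderiv_of_isOpen hΩ le_rfl).clm_apply
      continuousOn_const

theorem ContDiffOn.continuousOn_inner_gradient (hΩ : IsOpen Ω)
    {W : EuclideanSpace ℝ (Fin n) → ℝ} (hW : ContDiffOn ℝ 1 W Ω) (hb : ContinuousOn b Ω) :
    ContinuousOn (fun x => ⟪b x, gradient W x⟫) Ω := by
  simp only [inner_gradient_right]
  exact ((hW.continuousOn_fderiv_of_isOpen hΩ le_rfl).clm_apply hb)

theorem integrableOn_mul_add_bounded_mul (hΩ : IsOpen Ω) (hc : Measurable c)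
    (hcB : ∃ M : ℝ, ∀ x ∈ Ω, |c x| ≤ M) {F G : EuclideanSpace ℝ (Fin n) → ℝ}
    {K : Set (EuclideanSpace ℝ (Fin n))} (hK : IsCompact K) (hKΩ : K ⊆ Ω)
    (hF : ContinuousOn F Ω) (hG : ContinuousOn G Ω)
    (hF0 : ∀ x, x ∉ K → F x = 0) (hG0 : ∀ x, x ∉ K → G x = 0) :
    IntegrableOn (fun x => F x + c x * G x) Ω := by
  obtain ⟨M, hM⟩ := hcB
  refine (hF.integrableOn_of_eq_zero_off_compact hK hKΩ hΩ hF0).add ?_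
  exact (hG.integrableOn_of_eq_zero_off_compact hK hKΩ hΩ hG0).bdd_mul (c := M)
    hc.aestronglyMeasurable (ae_restrict_of_forall_mem hΩ.measurableSet hM)

/-- The formal adjoint of `-Δ + b·∇ + c` applied to a test function is integrable against every
continuous function. -/
theorem integrableOn_mul_adjoint (hΩ : IsOpen Ω) (hb : ContDiffOn ℝ 1 b Ω)
    (hc : Measurable c) (hcB : ∃ M : ℝ, ∀ x ∈ Ω, |c x| ≤ M) (hφ : ContDiff ℝ 2 φ)
    (hφc : HasCompactSupport φ) (hφs : tsupport φ ⊆ Ω)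
    {W : EuclideanSpace ℝ (Fin n) → ℝ} (hW : ContinuousOn W Ω) :
    IntegrableOn (fun x => W x *
      (-(∑ i, fderiv ℝ (fun z => fderiv ℝ φ z (EuclideanSpace.single i 1)) x
            (EuclideanSpace.single i 1))
        - (∑ i, fderiv ℝ (fun z => φ z * b z i) x (EuclideanSpace.single i 1))
        + c x * φ x)) Ω := by
  have hb' : ∀ i, ContDiffOn ℝ 1 (fun z => b z i) Ω := fun i => by fun_prop
  have hdiv : ContinuousOn
      (fun x => ∑ i, fderiv ℝ (fun z => φ z * b z i) x (EuclideanSpace.single i 1)) Ω :=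
    continuousOn_finsetSum _ fun i _ =>
      (((hφ.of_le (by norm_num)).contDiffOn.mul (hb' i)).continuousOn_fderiv_of_isOpen hΩ
        le_rfl).clm_apply continuousOn_const
  refine (integrableOn_mul_add_bounded_mul (K := tsupport φ) (G := fun x => W x * φ x)
    (F := fun x => W x *
      (-(∑ i, fderiv ℝ (fun z => fderiv ℝ φ z (EuclideanSpace.single i 1)) x
            (EuclideanSpace.single i 1))
        - (∑ i, fderiv ℝ (fun z => φ z * b z i) x (EuclideanSpace.single i 1))))
    hΩ hc hcB hφc hφs (hW.mul
      ((hφ.contDiffOn.continuousOn_laplacian_sum hΩ).neg.sub hdiv))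
    (hW.mul hφ.continuous.continuousOn) (fun x hx => ?_) (fun x hx => ?_)).congr_fun
    (fun x _ => by ring) hΩ.measurableSet
  · have h1 : ∀ i, fderiv ℝ (fun z => fderiv ℝ φ z (EuclideanSpace.single i 1)) x = 0 :=
      fun i => fderiv_of_notMem_tsupport ℝ fun h => hx (tsupport_fderiv_apply_subset ℝ _ h)
    have h2 : ∀ i, fderiv ℝ (fun z => φ z * b z i) x = 0 :=
      fun i => fderiv_of_notMem_tsupport ℝ fun h => hx (tsupport_mul_subset_left h)
    simp [h1, h2]
  · simp [image_eq_zero_of_notMem_tsupport hx]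

theorem integrableOn_testFunction_mul (hΩ : IsOpen Ω)
    (hc : Measurable c) (hcB : ∃ M : ℝ, ∀ x ∈ Ω, |c x| ≤ M) (hφ : Continuous φ)
    (hφc : HasCompactSupport φ) (hφs : tsupport φ ⊆ Ω)
    {F G : EuclideanSpace ℝ (Fin n) → ℝ} (hF : ContinuousOn F Ω) (hG : ContinuousOn G Ω) :
    IntegrableOn (fun x => φ x * (F x + c x * G x)) Ω :=
  (integrableOn_mul_add_bounded_mul (K := tsupport φ) (F := fun x => φ x * F x)
    (G := fun x => φ x * G x) hΩ hc hcB hφc hφs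
    (hφ.continuousOn.mul hF) (hφ.continuousOn.mul hG)
    (fun x hx => by simp [image_eq_zero_of_notMem_tsupport hx])
    (fun x hx => by simp [image_eq_zero_of_notMem_tsupport hx])).congr_fun
    (fun x _ => by ring) hΩ.measurableSet

/-- Green's identity for the operator `-Δ + b·∇ + c` against a test function. -/
theorem setIntegral_mul_adjoint_eq (hΩ : IsOpen Ω) (hb : ContDiffOn ℝ 1 b Ω)
    (hc : Measurable c) (hcB : ∃ M : ℝ, ∀ x ∈ Ω, |c x| ≤ M) (hφ : ContDiff ℝ 2 φ)
    (hφc : HasCompactSupport φ) (hφs : tsupport φ ⊆ Ω)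
    {W : EuclideanSpace ℝ (Fin n) → ℝ} (hW : ContDiffOn ℝ 2 W Ω) :
    (∫ x in Ω, W x *
      (-(∑ i, fderiv ℝ (fun z => fderiv ℝ φ z (EuclideanSpace.single i 1)) x
            (EuclideanSpace.single i 1))
        - (∑ i, fderiv ℝ (fun z => φ z * b z i) x (EuclideanSpace.single i 1))
        + c x * φ x)) =
      ∫ x in Ω, φ x *
        (-(∑ i, fderiv ℝ (fun z => fderiv ℝ W z (EuclideanSpace.single i 1)) x
            (EuclideanSpace.single i 1)) + ⟪b x, gradient W x⟫ + c x * W x) := by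
  have hW1 : ContDiffOn ℝ 1 W Ω := hW.of_le (by norm_num)
  have hφ1 : ContDiffOn ℝ 1 φ Ω := (hφ.of_le (by norm_num)).contDiffOn
  have hb' : ∀ i, ContDiffOn ℝ 1 (fun z => b z i) Ω := fun i => by fun_prop
  have hφb : ∀ i, ContDiffOn ℝ 1 (fun z => φ z * b z i) Ω := fun i => hφ1.mul (hb' i)
  have hφ0 : ∀ x, x ∉ tsupport φ → φ x = 0 := fun x hx => image_eq_zero_of_notMem_tsupport hx
  have int : ∀ h : EuclideanSpace ℝ (Fin n) → ℝ, ContinuousOn h Ω →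
      (∀ x, x ∉ tsupport φ → h x = 0) → IntegrableOn h Ω := fun h hh h0 =>
    hh.integrableOn_of_eq_zero_off_compact hφc hφs hΩ h0
  have d2 : ∀ {F : EuclideanSpace ℝ (Fin n) → ℝ}, ContDiffOn ℝ 1 F Ω →
      ∀ e, ContinuousOn (fun x => fderiv ℝ F x e) Ω := fun hF e =>
    (hF.continuousOn_fderiv_of_isOpen hΩ le_rfl).clm_apply continuousOn_const
  have hL1 : ∀ i : Fin n, IntegrableOn (fun x => W x *
      fderiv ℝ (fun z => fderiv ℝ φ z (EuclideanSpace.single i 1)) x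
        (EuclideanSpace.single i 1)) Ω := fun i =>
    int _ (hW.continuousOn.mul (d2 (hφ.contDiffOn.fderiv_apply_const hΩ _) _)) fun x hx => by
      rw [fderiv_of_notMem_tsupport ℝ fun h => hx (tsupport_fderiv_apply_subset ℝ _ h)]; simp
  have hL2 : ∀ i : Fin n, IntegrableOn (fun x => W x *
      fderiv ℝ (fun z => φ z * b z i) x (EuclideanSpace.single i 1)) Ω := fun i =>
    int _ (hW.continuousOn.mul (d2 (hφb i) _)) fun x hx => by
      rw [fderiv_of_notMem_tsupport ℝ fun h => hx (tsupport_mul_subset_left h)]; simp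
  have hR1 : ∀ i : Fin n, IntegrableOn (fun x =>
      fderiv ℝ (fun z => fderiv ℝ W z (EuclideanSpace.single i 1)) x
        (EuclideanSpace.single i 1) * φ x) Ω := fun i =>
    int _ ((d2 (hW.fderiv_apply_const hΩ _) _).mul hφ1.continuousOn) fun x hx => by
      simp [hφ0 x hx]
  have hR2 : ∀ i : Fin n, IntegrableOn (fun x =>
      fderiv ℝ W x (EuclideanSpace.single i 1) * (φ x * b x i)) Ω := fun i =>
    int _ ((d2 hW1 _).mul (hφb i).continuousOn) fun x hx => by simp [hφ0 x hx]
  have hC : IntegrableOn (fun x => φ x * (0 + c x * W x)) Ω :=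
    integrableOn_testFunction_mul hΩ hc hcB hφ.continuous hφc hφs continuousOn_const
      hW.continuousOn
  have hl : ∀ x, W x *
      (-(∑ i, fderiv ℝ (fun z => fderiv ℝ φ z (EuclideanSpace.single i 1)) x
            (EuclideanSpace.single i 1))
        - (∑ i, fderiv ℝ (fun z => φ z * b z i) x (EuclideanSpace.single i 1))
        + c x * φ x) =
      -(∑ i, W x * fderiv ℝ (fun z => fderiv ℝ φ z (EuclideanSpace.single i 1)) x
            (EuclideanSpace.single i 1))
        - (∑ i, W x * fderiv ℝ (fun z => φ z * b z i) x (EuclideanSpace.single i 1))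
        + φ x * (0 + c x * W x) := fun x => by
    rw [← Finset.mul_sum, ← Finset.mul_sum]; ring
  have hr : ∀ x, φ x *
        (-(∑ i, fderiv ℝ (fun z => fderiv ℝ W z (EuclideanSpace.single i 1)) x
            (EuclideanSpace.single i 1)) + ⟪b x, gradient W x⟫ + c x * W x) =
      -(∑ i, fderiv ℝ (fun z => fderiv ℝ W z (EuclideanSpace.single i 1)) x
            (EuclideanSpace.single i 1) * φ x)
        + (∑ i, fderiv ℝ W x (EuclideanSpace.single i 1) * (φ x * b x i))
        + φ x * (0 + c x * W x) := fun x => by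
    have : ∑ i, fderiv ℝ W x (EuclideanSpace.single i 1) * (φ x * b x i) =
        φ x * ⟪b x, gradient W x⟫ := by
      rw [inner_gradient_eq_sum, Finset.mul_sum]
      exact Finset.sum_congr rfl fun i _ => by ring
    rw [this, ← Finset.sum_mul]; ring
  simp only [hl, hr]
  have sL1 := integrable_finsetSum Finset.univ fun i _ => hL1 i
  have sL2 := integrable_finsetSum Finset.univ fun i _ => hL2 i
  have sR1 := integrable_finsetSum Finset.univ fun i _ => hR1 i
  have sR2 := integrable_finsetSum Finset.univ fun i _ => hR2 i
  rw [integral_add (by exact sL1.neg.sub sL2) hC, integral_add (by exact sR1.neg.add sR2) hC,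
    integral_sub (by exact sL1.neg) sL2, integral_add (by exact sR1.neg) sR2, integral_neg,
    integral_neg,
    integral_finsetSum _ fun i _ => hL1 i, integral_finsetSum _ fun i _ => hL2 i,
    integral_finsetSum _ fun i _ => hR1 i, integral_finsetSum _ fun i _ => hR2 i]
  have e1 := fun i : Fin n => setIntegral_mul_fderiv_fderiv_eq (μ := volume) hΩ hW hφ.contDiffOn
    hφc hφs (EuclideanSpace.single i 1)
  have e2 := fun i : Fin n => setIntegral_mul_fderiv_eq_neg (μ := volume) hΩ hW1 (hφb i)
    hφc.mul_right (tsupport_mul_subset_left.trans hφs) (EuclideanSpace.single i 1)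
  simp only [e1, e2, Finset.sum_neg_distrib, sub_neg_eq_add]

end Operator

/-- If `-Δu + b·∇u + cu = f` and `-Δv + b·∇v + cv = g` pointwise in an open set `Ω`, then
`w = max{u,v}` satisfies `-Δw + b·∇w + cw ≤ f χ_{u>v} + g χ_{u≤v}` in the sense of
distributions on `Ω`. -/
theorem max_of_solutions_is_distributional_subsolution
    (n : ℕ) (Ω : Set (EuclideanSpace ℝ (Fin n))) (hΩ : IsOpen Ω)
    (u v f g : EuclideanSpace ℝ (Fin n) → ℝ)
    (hu : ContDiffOn ℝ 2 u Ω) (hv : ContDiffOn ℝ 2 v Ω)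
    (hf : ContDiffOn ℝ 2 f Ω) (hg : ContDiffOn ℝ 2 g Ω)
    (b : EuclideanSpace ℝ (Fin n) → EuclideanSpace ℝ (Fin n))
    (hb : ContDiffOn ℝ 1 b Ω)
    (c : EuclideanSpace ℝ (Fin n) → ℝ) (hc : Measurable c)
    (hcB : ∃ Mc : ℝ, ∀ x ∈ Ω, |c x| ≤ Mc)
    (hueq : ∀ x ∈ Ω,
      -(∑ i, fderiv ℝ (fun z => fderiv ℝ u z (EuclideanSpace.single i 1)) x
          (EuclideanSpace.single i 1))
        + ⟪b x, gradient u x⟫ + c x * u x = f x)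
    (hveq : ∀ x ∈ Ω,
      -(∑ i, fderiv ℝ (fun z => fderiv ℝ v z (EuclideanSpace.single i 1)) x
          (EuclideanSpace.single i 1))
        + ⟪b x, gradient v x⟫ + c x * v x = g x) :
    ∀ φ : EuclideanSpace ℝ (Fin n) → ℝ,
      ContDiff ℝ (⊤ : ℕ∞) φ → HasCompactSupport φ → tsupport φ ⊆ Ω → (∀ x, 0 ≤ φ x) →
      (∫ x in Ω, max (u x) (v x) *
          (-(∑ i, fderiv ℝ (fun z => fderiv ℝ φ z (EuclideanSpace.single i 1)) x
                (EuclideanSpace.single i 1))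
            - (∑ i, fderiv ℝ (fun z => φ z * b z i) x (EuclideanSpace.single i 1))
            + c x * φ x))
        ≤ ∫ x in Ω, φ x * (if v x < u x then f x else g x) := by
  intro φ hφ' hφc hφs hφ0
  have hφ : ContDiff ℝ 2 φ := contDiff_infty.mp hφ' 2
  obtain ⟨M, hM⟩ := id hcB
  have huc := hu.continuousOn
  have hvc := hv.continuousOn
  have hfc := hf.continuousOn
  have hgc := hg.continuousOn
  have hσ : ∀ k : ℝ, ContinuousOn (fun x => sigmoid (k ^ 2 * (u x - v x) - k)) Ω := fun k =>
    continuous_sigmoid.comp_continuousOn (by fun_prop)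
  have hWk : ∀ k : ℝ, ContDiffOn ℝ 2 (fun x => v x + smoothPosPart k (u x - v x)) Ω := fun k =>
    hv.add ((contDiff_smoothPosPart k).comp_contDiffOn (hu.sub hv))
  have hWbound : ∀ k : ℝ, 1 ≤ k → ∀ x,
      |v x + smoothPosPart k (u x - v x)| ≤ |v x| + |u x - v x| + 1 := fun k hk x => by
    have h1 := abs_smoothPosPart_sub_max_le hk (u x - v x)
    have h2 : 1 / k ≤ 1 := by rw [div_le_one (by linarith)]; exact hk
    have h3 : |max (u x - v x) 0| ≤ |u x - v x| := by
      rw [abs_of_nonneg (le_max_right _ _)]; exact max_le (le_abs_self _) (abs_nonneg _)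
    have h4 := abs_add_le (v x) (smoothPosPart k (u x - v x))
    have h5 := abs_add_le (smoothPosPart k (u x - v x) - max (u x - v x) 0) (max (u x - v x) 0)
    rw [sub_add_cancel] at h5
    linarith
  have hR : ∀ k : ℝ, IntegrableOn (fun x => φ x *
      ((g x + sigmoid (k ^ 2 * (u x - v x) - k) * (f x - g x)) +
        c x * (smoothPosPart k (u x - v x) -
          sigmoid (k ^ 2 * (u x - v x) - k) * (u x - v x)))) Ω := fun k =>
    integrableOn_testFunction_mul hΩ hc hcB hφ.continuous hφc hφs
      (hgc.add ((hσ k).mul (hfc.sub hgc)))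
      (((contDiff_smoothPosPart k (m := 0)).continuous.comp_continuousOn (huc.sub hvc)).sub
        ((hσ k).mul (huc.sub hvc)))
  refine le_of_tendsto_of_tendsto
    (f := fun k : ℝ => ∫ x in Ω, (v x + smoothPosPart k (u x - v x)) *
          (-(∑ i, fderiv ℝ (fun z => fderiv ℝ φ z (EuclideanSpace.single i 1)) x
                (EuclideanSpace.single i 1))
            - (∑ i, fderiv ℝ (fun z => φ z * b z i) x (EuclideanSpace.single i 1))
            + c x * φ x))
    (g := fun k : ℝ => ∫ x in Ω, φ x *
      ((g x + sigmoid (k ^ 2 * (u x - v x) - k) * (f x - g x)) +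
        c x * (smoothPosPart k (u x - v x) -
          sigmoid (k ^ 2 * (u x - v x) - k) * (u x - v x))))
    (b := Filter.atTop) ?_ ?_ ?_
  · refine tendsto_integral_filter_of_dominated_convergence _
      (.of_forall fun k => (integrableOn_mul_adjoint hΩ hb hc hcB hφ hφc hφs
        (hWk k).continuousOn).aestronglyMeasurable) ?_
      (integrableOn_mul_adjoint hΩ hb hc hcB hφ hφc hφs
        (W := fun x => |v x| + |u x - v x| + 1) (by fun_prop)).norm ?_
    · filter_upwards [Filter.eventually_ge_atTop 1] with k hk
      refine .of_forall fun x => ?_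
      rw [norm_mul, norm_mul]
      refine mul_le_mul_of_nonneg_right ?_ (norm_nonneg _)
      rw [Real.norm_eq_abs, Real.norm_eq_abs]
      exact (hWbound k hk x).trans (le_abs_self _)
    · refine .of_forall fun x => Filter.Tendsto.mul_const _ ?_
      have : max (u x) (v x) = v x + max (u x - v x) 0 := by
        rw [← max_add_add_left]; simp
      rw [this]
      exact (tendsto_smoothPosPart _).const_add _
  · refine tendsto_integral_filter_of_dominated_convergence
      (fun x => φ x * ((|g x| + |f x - g x| + M * (|v x| + (|v x| + |u x - v x| + 1) + |u x - v x|))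
        + c x * 0))
      (.of_forall fun k => (hR k).aestronglyMeasurable) ?_
      (integrableOn_testFunction_mul hΩ hc hcB hφ.continuous hφc hφs (by fun_prop)
        continuousOn_const) ?_
    · filter_upwards [Filter.eventually_ge_atTop 1] with k hk
      refine ae_restrict_of_forall_mem hΩ.measurableSet fun x hx => ?_
      rw [norm_mul, Real.norm_of_nonneg (hφ0 x)]
      refine mul_le_mul_of_nonneg_left ?_ (hφ0 x)
      have hs : |sigmoid (k ^ 2 * (u x - v x) - k)| ≤ 1 := by
        rw [abs_of_nonneg (sigmoid_nonneg _)]; exact sigmoid_le_one _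
      generalize sigmoid (k ^ 2 * (u x - v x) - k) = s at hs ⊢
      have hs' : ∀ y : ℝ, |s * y| ≤ |y| := fun y => by
        rw [abs_mul]; exact mul_le_of_le_one_left (abs_nonneg y) hs
      have hj : |smoothPosPart k (u x - v x)| ≤ |v x| + (|v x| + |u x - v x| + 1) := by
        have h1 := abs_sub (v x + smoothPosPart k (u x - v x)) (v x)
        rw [add_sub_cancel_left] at h1
        linarith [hWbound k hk x]
      have h2 := abs_sub (smoothPosPart k (u x - v x)) (s * (u x - v x))
      have hq : |c x * (smoothPosPart k (u x - v x) - s * (u x - v x))| ≤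
          M * (|v x| + (|v x| + |u x - v x| + 1) + |u x - v x|) := by
        rw [abs_mul]
        exact mul_le_mul (hM x hx) (by linarith [hs' (u x - v x)]) (abs_nonneg _)
          ((abs_nonneg _).trans (hM x hx))
      rw [Real.norm_eq_abs, mul_zero, add_zero]
      refine (abs_add_le _ _).trans (add_le_add ((abs_add_le _ _).trans ?_) hq)
      linarith [hs' (f x - g x)]
    · refine .of_forall fun x => Filter.Tendsto.const_mul _ ?_
      have hs := tendsto_sigmoid_rescaled (u x - v x)
      have hj := tendsto_smoothPosPart (u x - v x)
      have := ((hs.mul_const (f x - g x)).const_add (g x)).add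
        ((hj.sub (hs.mul_const (u x - v x))).const_mul (c x))
      convert this using 2
      by_cases h : v x < u x
      · rw [if_pos h, if_pos (sub_pos.mpr h), max_eq_left (sub_pos.mpr h).le]; ring
      · have h' : ¬ 0 < u x - v x := by rwa [sub_pos]
        rw [if_neg h, if_neg h', max_eq_right (not_lt.mp h')]; ring
  · filter_upwards [Filter.eventually_ge_atTop 1] with k hk
    rw [setIntegral_mul_adjoint_eq hΩ hb hc hcB hφ hφc hφs (hWk k)]
    refine setIntegral_mono_on (integrableOn_testFunction_mul hΩ hc hcB hφ.continuous hφc hφs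
      (((hWk k).continuousOn_laplacian_sum hΩ).neg.add
        (((hWk k).of_le (by norm_num)).continuousOn_inner_gradient hΩ hb.continuousOn))
      (hWk k).continuousOn) (hR k) hΩ.measurableSet fun x hx => ?_
    refine mul_le_mul_of_nonneg_left ?_ (hφ0 x)
    have hsum := Finset.sum_le_sum fun (i : Fin n) (_ : i ∈ Finset.univ) =>
      le_fderiv_fderiv_add_smoothPosPart_sub hk hΩ hu hv hx (EuclideanSpace.single i 1)
    rw [Finset.sum_add_distrib, ← Finset.mul_sum, Finset.sum_sub_distrib] at hsum
    have hgrad : ⟪b x, gradient (fun z => v z + smoothPosPart k (u z - v z)) x⟫ =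
        ⟪b x, gradient v x⟫ + sigmoid (k ^ 2 * (u x - v x) - k) *
          (⟪b x, gradient u x⟫ - ⟪b x, gradient v x⟫) := by
      simp only [inner_gradient_right]
      rw [fderiv_add_smoothPosPart_sub hk
        ((hu.differentiableOn two_ne_zero).differentiableAt (hΩ.mem_nhds hx))
        ((hv.differentiableOn two_ne_zero).differentiableAt (hΩ.mem_nhds hx))]
      simp
    rw [hgrad, ← hueq x hx, ← hveq x hx]
    linarith
end

section
/- Let $n \ge 2$, $s \in (0,1)$. Suppose $v : \mathbb{R}^n \to \mathbb{R}$ is smooth, bounded, with $0 \le v \le m$ on $\mathbb{R}^n$ and $v = m$ on the annulus $B_{7/8} \setminus B_{5/8}$, and suppose $v$ attains its minimum over $\overline{B_{7/8}}$ at an interior point $\bar{x} \in B_{5/8}$. If $(-\Delta)^s v(\bar{x}) + M v(\bar{x}) \ge 0$ for some constant $M > 0$, then $v(\bar{x}) \ge \frac{M_2}{M_1 + M_2 + M}\, m$, where $M_1 = \int_{|y|\ge 7/8}\frac{C_{n,s}}{(|y|-5/8)^{n+2s}}dy$ and $M_2 = \int_{5/8\le|y|\le7/8}\frac{C_{n,s}}{|y|^{n+2s}}dy$.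 -/
open MeasureTheory Metric Real

section

open Set

theorem lintegral_eq_lintegral_toSphere {E : Type*} [NormedAddCommGroup E] [NormedSpace ℝ E]
    [FiniteDimensional ℝ E] [Nontrivial E] [MeasurableSpace E] [BorelSpace E]
    (μ : Measure E) [μ.IsAddHaarMeasure] {f : E → ENNReal} (hf : Measurable f) :
    ∫⁻ x, f x ∂μ = ∫⁻ ω : sphere (0 : E) 1, (∫⁻ r in Ioi (0 : ℝ),
      ENNReal.ofReal (r ^ (Module.finrank ℝ E - 1)) * f (r • (ω : E))) ∂μ.toSphere := by
  have hcont : Continuous fun p : sphere (0 : E) 1 × Ioi (0 : ℝ) ↦ (p.2 : ℝ) • (p.1 : E) := by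
    fun_prop
  calc ∫⁻ x, f x ∂μ = ∫⁻ x : ({0}ᶜ : Set E), f x ∂(μ.comap (↑)) := by
        rw [lintegral_subtype_comap (measurableSet_singleton _).compl, restrict_compl_singleton]
    _ = ∫⁻ p : sphere (0 : E) 1 × Ioi (0 : ℝ), f ((p.2 : ℝ) • (p.1 : E))
          ∂(μ.toSphere.prod (.volumeIoiPow (Module.finrank ℝ E - 1))) := by
        refine Eq.trans ?_ (μ.measurePreserving_homeomorphUnitSphereProd.lintegral_comp
          (hf.comp hcont.measurable))
        refine lintegral_congr fun x ↦ ?_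
        congr 1
        exact (congrArg Subtype.val ((homeomorphUnitSphereProd E).symm_apply_apply x)).symm
    _ = _ := by
        refine (lintegral_prod _ (hf.comp hcont.measurable).aemeasurable).trans ?_
        refine lintegral_congr fun ω ↦ ?_
        rw [Measure.volumeIoiPow, lintegral_withDensity_eq_lintegral_mul _ (by fun_prop)
          (by fun_prop)]
        exact lintegral_subtype_comap measurableSet_Ioi
          fun r : ℝ ↦ ENNReal.ofReal (r ^ (Module.finrank ℝ E - 1)) * f (r • (ω : E))

theorem two_mul_rpow_le_rpow_sub_add_rpow_add {S a k : ℝ} (hk : 0 ≤ k) (ha : |a| < S) :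
    2 * S ^ (-k) ≤ (S - a) ^ (-k) + (S + a) ^ (-k) := by
  obtain ⟨h1, h2⟩ := abs_lt.1 ha
  have hS : 0 < S := (abs_nonneg a).trans_lt ha
  have h3 : 0 < S - a := by linarith
  have h4 : 0 < S + a := by linarith
  have key : (S ^ (-k)) ^ 2 ≤ (S - a) ^ (-k) * (S + a) ^ (-k) := by
    rw [sq, ← mul_rpow hS.le hS.le, ← mul_rpow h3.le h4.le]
    exact rpow_le_rpow_of_nonpos (by positivity) (by nlinarith [sq_nonneg a]) (by linarith)
  refine abs_le_of_sq_le_sq' ?_ (by positivity) |>.2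
  nlinarith [sq_nonneg ((S - a) ^ (-k) - (S + a) ^ (-k))]

theorem antitoneOn_rpow_chord {a b q : ℝ} (hq : 0 < q) (hab : |a| ≤ b) :
    AntitoneOn (fun r ↦ (√(r ^ 2 - (b ^ 2 - a ^ 2)) - a) ^ (-q)
      + (√(r ^ 2 - (b ^ 2 - a ^ 2)) + a) ^ (-q) - 2 * r ^ (-q)) (Ioi b) := by
  have hb : 0 ≤ b := (abs_nonneg a).trans hab
  have hc : a ^ 2 ≤ b ^ 2 := sq_le_sq.2 (hab.trans (le_abs_self b))
  have hS : ∀ r ∈ Ioi b, |a| < √(r ^ 2 - (b ^ 2 - a ^ 2)) := fun r hr ↦ by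
    rw [← sqrt_sq_eq_abs]
    exact sqrt_lt_sqrt (sq_nonneg a) (by nlinarith [mem_Ioi.1 hr])
  have hd : ∀ r ∈ Ioi b, HasDerivAt (fun r ↦ (√(r ^ 2 - (b ^ 2 - a ^ 2)) - a) ^ (-q)
      + (√(r ^ 2 - (b ^ 2 - a ^ 2)) + a) ^ (-q) - 2 * r ^ (-q))
      (q * (2 * r ^ (-(q + 1)) - r / √(r ^ 2 - (b ^ 2 - a ^ 2)) *
        ((√(r ^ 2 - (b ^ 2 - a ^ 2)) - a) ^ (-(q + 1))
          + (√(r ^ 2 - (b ^ 2 - a ^ 2)) + a) ^ (-(q + 1))))) r := fun r hr ↦ by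
    have h0 := hS r hr
    obtain ⟨h1, h2⟩ := abs_lt.1 h0
    have hpos : 0 < √(r ^ 2 - (b ^ 2 - a ^ 2)) := (abs_nonneg a).trans_lt h0
    have hs : HasDerivAt (fun r ↦ √(r ^ 2 - (b ^ 2 - a ^ 2)))
        (2 * r / (2 * √(r ^ 2 - (b ^ 2 - a ^ 2)))) r := by
      simpa using ((hasDerivAt_pow 2 r).sub_const (b ^ 2 - a ^ 2)).sqrt (sqrt_pos.1 hpos).ne'
    have e1 := (hs.sub_const a).rpow_const (p := -q) (Or.inl (by linarith))
    have e2 := (hs.add_const a).rpow_const (p := -q) (Or.inl (by linarith))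
    have e3 := (hasDerivAt_rpow_const (p := -q)
      (Or.inl (hb.trans_lt hr).ne')).const_mul 2
    refine ((e1.add e2).sub e3).congr_deriv ?_
    rw [show -(q + 1) = -q - 1 by ring]
    field_simp
    ring
  refine antitoneOn_of_deriv_nonpos (convex_Ioi b)
    (fun r hr ↦ (hd r hr).continuousAt.continuousWithinAt)
    (fun r hr ↦ (hd r (interior_subset hr)).differentiableAt.differentiableWithinAt)
    fun r hr ↦ ?_
  replace hr := interior_subset hr
  rw [(hd r hr).deriv]
  have h0 := hS r hr
  have hr0 : 0 < r := hb.trans_lt hr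
  have hpos : 0 < √(r ^ 2 - (b ^ 2 - a ^ 2)) := (abs_nonneg a).trans_lt h0
  have hSr : √(r ^ 2 - (b ^ 2 - a ^ 2)) ≤ r :=
    sqrt_le_iff.2 ⟨hr0.le, by linarith⟩
  have j := two_mul_rpow_le_rpow_sub_add_rpow_add (k := q + 1) (by linarith) h0
  set S := √(r ^ 2 - (b ^ 2 - a ^ 2))
  have hp : r ^ (-(q + 1)) ≤ S ^ (-(q + 1)) :=
    rpow_le_rpow_of_nonpos hpos hSr (by linarith)
  have hq1 : 1 ≤ r / S := (one_le_div hpos).2 hSr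
  have hrp : 0 < r ^ (-(q + 1)) := rpow_pos_of_pos hr0 _
  refine mul_nonpos_of_nonneg_of_nonpos hq.le ?_
  have hmean : r ^ (-(q + 1)) ≤ ((S - a) ^ (-(q + 1)) + (S + a) ^ (-(q + 1))) / 2 := by
    linarith
  nlinarith [mul_le_mul hq1 hmean hrp.le (by linarith)]

theorem le_norm_add_smul_iff {E : Type*} [NormedAddCommGroup E] [InnerProductSpace ℝ E]
    {x ω : E} (hω : ‖ω‖ = 1) {r t : ℝ} (hr : ‖x‖ < r) (ht : 0 < t) :
    r ≤ ‖x + t • ω‖ ↔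
      √(r ^ 2 - (‖x‖ ^ 2 - inner ℝ x ω ^ 2)) - inner ℝ x ω ≤ t := by
  have hx := norm_nonneg x
  have hsq : ‖x + t • ω‖ ^ 2 = ‖x‖ ^ 2 + 2 * t * inner ℝ x ω + t ^ 2 := by
    rw [norm_add_sq_real, inner_smul_right, norm_smul, hω, mul_one, norm_eq_abs, sq_abs]
    ring
  have hlt : -inner ℝ x ω < √(r ^ 2 - (‖x‖ ^ 2 - inner ℝ x ω ^ 2)) :=
    lt_sqrt_of_sq_lt (by nlinarith)
  set a := inner ℝ x ω
  have hpos : 0 ≤ r ^ 2 - (‖x‖ ^ 2 - a ^ 2) := by nlinarith [sq_nonneg a]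
  have hS := sq_sqrt hpos
  have hS0 := sqrt_nonneg (r ^ 2 - (‖x‖ ^ 2 - a ^ 2))
  set S := √(r ^ 2 - (‖x‖ ^ 2 - a ^ 2))
  rw [← pow_le_pow_iff_left₀ (hx.trans hr.le) (norm_nonneg _) two_ne_zero, hsq]
  constructor
  · intro h
    by_contra! h'
    nlinarith
  · intro h
    nlinarith

theorem setLIntegral_Ico_rpow {q u w : ℝ} (hq : 0 < q) (hu : 0 < u) (huw : u ≤ w) :
    ∫⁻ t in Ico u w, ENNReal.ofReal (t ^ (-q - 1)) =
      ENNReal.ofReal ((u ^ (-q) - w ^ (-q)) / q) := by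
  have h0 : (0 : ℝ) ∉ uIcc u w := by
    rw [uIcc_of_le huw]; exact fun h ↦ hu.not_ge h.1
  rw [Measure.restrict_congr_set Ico_ae_eq_Ioc, ← ofReal_integral_eq_lintegral_ofReal,
    ← intervalIntegral.integral_of_le huw, integral_rpow (Or.inr ⟨by linarith, h0⟩)]
  · congr 1
    rw [sub_add_cancel]
    field_simp
    ring
  · exact (intervalIntegral.intervalIntegrable_rpow (Or.inr h0)).1
  · filter_upwards [ae_restrict_mem measurableSet_Ioc] with t ht
    exact rpow_nonneg (hu.trans ht.1).le _

theorem lintegral_Ioi_pow_mul_indicator_shell {E : Type*} [NormedAddCommGroup E]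
    [InnerProductSpace ℝ E] {x ω : E} (hω : ‖ω‖ = 1) {r₁ r₂ q : ℝ} (hx : ‖x‖ < r₁)
    (hr : r₁ ≤ r₂) (hq : 0 < q) {d : ℕ} (hd : 1 ≤ d) :
    ∫⁻ t in Ioi (0 : ℝ), ENNReal.ofReal (t ^ (d - 1)) *
      {y : E | r₁ ≤ ‖x + y‖ ∧ ‖x + y‖ < r₂}.indicator
        (fun y ↦ ENNReal.ofReal (‖y‖ ^ (-(d + q)))) (t • ω) =
    ENNReal.ofReal
      (((√(r₁ ^ 2 - (‖x‖ ^ 2 - inner ℝ x ω ^ 2)) - inner ℝ x ω) ^ (-q)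
        - (√(r₂ ^ 2 - (‖x‖ ^ 2 - inner ℝ x ω ^ 2)) - inner ℝ x ω) ^ (-q)) / q) := by
  have h1 := fun t (ht : 0 < t) ↦ le_norm_add_smul_iff hω hx ht
  have h2 := fun t (ht : 0 < t) ↦ not_congr (le_norm_add_smul_iff hω (hx.trans_le hr) ht)
  simp only [not_le] at h2
  have hpos : inner ℝ x ω < √(r₁ ^ 2 - (‖x‖ ^ 2 - inner ℝ x ω ^ 2)) :=
    lt_sqrt_of_sq_lt (by nlinarith [norm_nonneg x])
  have hle : √(r₁ ^ 2 - (‖x‖ ^ 2 - inner ℝ x ω ^ 2))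
      ≤ √(r₂ ^ 2 - (‖x‖ ^ 2 - inner ℝ x ω ^ 2)) :=
    sqrt_le_sqrt (by nlinarith [norm_nonneg x])
  rw [← setLIntegral_Ico_rpow hq (sub_pos.2 hpos) (sub_le_sub_right hle _)]
  rw [← lintegral_indicator measurableSet_Ioi, ← lintegral_indicator measurableSet_Ico]
  congr 1 with t
  by_cases ht : 0 < t
  · rw [indicator_of_mem (mem_Ioi.2 ht)]
    simp only [indicator, mem_ofPred_eq, mem_Ico, h1 t ht, h2 t ht]
    split_ifs with h
    · rw [norm_smul, hω, mul_one, norm_of_nonneg ht.le, ← ENNReal.ofReal_mul (by positivity),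
        ← rpow_natCast, ← rpow_add ht, Nat.cast_sub hd]
      congr 2
      push_cast
      ring
    · simp
  · rw [indicator_of_notMem (by simpa using ht), indicator_of_notMem]
    exact fun h ↦ ht ((sub_pos.2 hpos).trans_le h.1)

theorem setLIntegral_shell_rpow_norm_le {E : Type*} [NormedAddCommGroup E]
    [InnerProductSpace ℝ E] [FiniteDimensional ℝ E] [Nontrivial E] [MeasurableSpace E]
    [BorelSpace E] (μ : Measure E) [μ.IsAddHaarMeasure] {x : E} {r₁ r₂ q : ℝ} (hx : ‖x‖ < r₁)
    (hr : r₁ ≤ r₂) (hq : 0 < q) :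
    ∫⁻ y in {y : E | r₁ ≤ ‖y‖ ∧ ‖y‖ < r₂},
        ENNReal.ofReal (‖y‖ ^ (-(Module.finrank ℝ E + q))) ∂μ ≤
      ∫⁻ y in {y : E | r₁ ≤ ‖x + y‖ ∧ ‖x + y‖ < r₂},
        ENNReal.ofReal (‖y‖ ^ (-(Module.finrank ℝ E + q))) ∂μ := by
  set J : E → ENNReal := fun x ↦ ∫⁻ y in {y : E | r₁ ≤ ‖x + y‖ ∧ ‖x + y‖ < r₂},
    ENNReal.ofReal (‖y‖ ^ (-(Module.finrank ℝ E + q))) ∂μ with hJ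
  set G : E → E → ℝ := fun x ω ↦ ((√(r₁ ^ 2 - (‖x‖ ^ 2 - inner ℝ x ω ^ 2)) - inner ℝ x ω) ^ (-q)
        - (√(r₂ ^ 2 - (‖x‖ ^ 2 - inner ℝ x ω ^ 2)) - inner ℝ x ω) ^ (-q)) / q with hG
  have hJ_set : ∀ z : E, MeasurableSet {y : E | r₁ ≤ ‖z + y‖ ∧ ‖z + y‖ < r₂} := fun z ↦
    (by fun_prop : Measurable fun y ↦ ‖z + y‖) measurableSet_Ico
  have hpolar : ∀ z : E, ‖z‖ < r₁ →
      J z = ∫⁻ ω : sphere (0 : E) 1, ENNReal.ofReal (G z ω) ∂μ.toSphere := fun z hz ↦ by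
    simp only [hJ]
    rw [← lintegral_indicator (hJ_set z), lintegral_eq_lintegral_toSphere μ
      (Measurable.indicator (by fun_prop) (hJ_set z))]
    exact lintegral_congr fun ω ↦ lintegral_Ioi_pow_mul_indicator_shell
      (by simp) hz hr hq Module.finrank_pos
  have hneg : J (-x) = J x := by
    simp only [hJ]
    rw [← lintegral_indicator (hJ_set _), ← lintegral_indicator (hJ_set _),
      ← lintegral_neg_eq_self]
    refine lintegral_congr fun y ↦ ?_
    simp only [indicator, mem_ofPred_eq, ← neg_add, norm_neg]
  have hr₁ : 0 < r₁ := (norm_nonneg x).trans_lt hx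
  have hpt : ∀ ω : sphere (0 : E) 1, ENNReal.ofReal (G 0 ω) + ENNReal.ofReal (G 0 ω) ≤
      ENNReal.ofReal (G x ω) + ENNReal.ofReal (G (-x) ω) := fun ω ↦ by
    have hanti := antitoneOn_rpow_chord (a := inner ℝ x ω) (b := ‖x‖) hq
      (by simpa using abs_real_inner_le_norm x ω) hx (hx.trans_le hr) hr
    have h0 : 0 ≤ G 0 ω := by
      simp only [hG, norm_zero, inner_zero_left]
      simp only [ne_eq, OfNat.ofNat_ne_zero, not_false_eq_true, zero_pow, sub_zero,
        sqrt_sq hr₁.le, sqrt_sq (hr₁.le.trans hr)]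
      exact div_nonneg (sub_nonneg.2 (rpow_le_rpow_of_nonpos hr₁ hr (by linarith))) hq.le
    rw [← ENNReal.ofReal_add h0 h0]
    refine (ENNReal.ofReal_le_ofReal ?_).trans ENNReal.ofReal_add_le
    simp only [hG, norm_zero, inner_zero_left, norm_neg, inner_neg_left, neg_sq,
      sub_neg_eq_add, ← add_div]
    simp only [ne_eq, OfNat.ofNat_ne_zero, not_false_eq_true, zero_pow, sub_zero,
        sqrt_sq hr₁.le, sqrt_sq (hr₁.le.trans hr)]
    refine div_le_div_of_nonneg_right ?_ hq.le
    simp only at hanti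
    linarith
  have hJ0 : J 0 + J 0 ≤ J x + J x := by
    calc J 0 + J 0 ≤ J x + J (-x) := ?_
      _ = J x + J x := by rw [hneg]
    rw [hpolar 0 (by simpa using hr₁), hpolar x hx, hpolar (-x) (by simpa using hx),
      ← lintegral_add_left (by fun_prop), ← lintegral_add_left (by fun_prop)]
    exact lintegral_mono hpt
  have : J 0 ≤ J x := by
    rw [← two_mul, ← two_mul] at hJ0
    exact (ENNReal.mul_le_mul_iff_right two_ne_zero ENNReal.ofNat_ne_top).1 hJ0
  simpa [hJ] using this

theorem integrableOn_const_div_rpow {E : Type*} [NormedAddCommGroup E] [NormedSpace ℝ E]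
    [FiniteDimensional ℝ E] [MeasurableSpace E] [BorelSpace E] (μ : Measure E)
    [μ.IsAddHaarMeasure] {A : Set E} (hA : MeasurableSet A) {φ : E → ℝ} (hφ : Measurable φ)
    {c p : ℝ} (C : ℝ) (hc : 0 < c) (hp : Module.finrank ℝ E < p)
    (h : ∀ y ∈ A, c * (1 + ‖y‖) ≤ φ y) :
    IntegrableOn (fun y ↦ C / φ y ^ p) A μ := by
  refine Integrable.mono' ((integrable_one_add_norm hp).const_mul (|C| * c ^ (-p))).integrableOn
    (by fun_prop : Measurable fun y ↦ C / φ y ^ p).aestronglyMeasurable ?_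
  filter_upwards [ae_restrict_mem hA] with y hy
  have h1 : 0 < c * (1 + ‖y‖) := by positivity
  have hφy := h1.trans_le (h y hy)
  rw [norm_div, norm_eq_abs, norm_of_nonneg (rpow_nonneg hφy.le _), div_eq_mul_inv,
    ← rpow_neg hφy.le, mul_assoc, ← mul_rpow hc.le (by positivity)]
  exact mul_le_mul_of_nonneg_left
    (rpow_le_rpow_of_nonpos h1 (h y hy)
      (by linarith [Nat.cast_nonneg (α := ℝ) (Module.finrank ℝ E)]))
    (abs_nonneg C)

theorem exists_abs_sub_le_mul_norm_sq_of_fderiv_eq_zero {E : Type*} [NormedAddCommGroup E]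
    [NormedSpace ℝ E] {f : E → ℝ} {x : E} (hf : ContDiff ℝ 2 f) (h0 : fderiv ℝ f x = 0) :
    ∃ K δ : ℝ, 0 ≤ K ∧ 0 < δ ∧ ∀ y, ‖y‖ < δ → |f x - f (x + y)| ≤ K * ‖y‖ ^ 2 := by
  have hd : DifferentiableAt ℝ (fderiv ℝ f) x :=
    ((hf.fderiv_right (m := 1) (by norm_num)).differentiable one_ne_zero) x
  obtain ⟨K, hK, hbound⟩ := hd.hasFDerivAt.isBigO_sub.exists_pos
  rw [Asymptotics.isBigOWith_iff, Metric.eventually_nhds_iff] at hbound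
  obtain ⟨δ, hδ, hbound⟩ := hbound
  refine ⟨K, δ, hK.le, hδ, fun y hy ↦ ?_⟩
  have := (convex_closedBall x ‖y‖).norm_image_sub_le_of_norm_fderiv_le (𝕜 := ℝ) (f := f)
    (C := K * ‖y‖) (x := x) (y := x + y)
    (fun z _ ↦ (hf.differentiable two_ne_zero) z) (fun z hz ↦ ?_)
    (mem_closedBall_self (norm_nonneg y)) (by simp)
  · rw [add_sub_cancel_left, norm_sub_rev, norm_eq_abs] at this
    linarith
  · rw [mem_closedBall] at hz
    have := hbound (hz.trans_lt hy)
    rw [h0, sub_zero, ← dist_eq_norm] at this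
    exact this.trans (mul_le_mul_of_nonneg_left hz hK.le)

theorem integrable_sub_div_rpow_norm {E : Type*} [NormedAddCommGroup E] [NormedSpace ℝ E]
    [FiniteDimensional ℝ E] [Nontrivial E] [MeasurableSpace E] [BorelSpace E] (μ : Measure E)
    [μ.IsAddHaarMeasure] {f : E → ℝ} {x : E} {B p : ℝ} (hf : ContDiff ℝ 2 f)
    (h0 : fderiv ℝ f x = 0) (hB : ∀ y, |f x - f y| ≤ B) (hp : Module.finrank ℝ E < p)
    (hp2 : p < Module.finrank ℝ E + 2) :
    Integrable (fun y ↦ (f x - f (x + y)) / ‖y‖ ^ p) μ := by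
  obtain ⟨K, δ, hK0, hδ, hK⟩ := exists_abs_sub_le_mul_norm_sq_of_fderiv_eq_zero hf h0
  have hfm : Measurable f := hf.continuous.measurable
  have hnear : IntegrableOn (fun y : E ↦ K * ‖y‖ ^ (2 - p)) (ball 0 δ) μ := by
    rw [integrableOn_fun_norm_addHaar μ (f := fun r ↦ K * r ^ (2 - p))]
    have : IntegrableOn (fun r : ℝ ↦ K * r ^ (Module.finrank ℝ E - 1 + (2 - p))) (Ioo 0 δ) :=
      ((intervalIntegral.integrableOn_Ioo_rpow_iff hδ).2 (by linarith)).const_mul K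
    refine this.congr_fun (fun r hr ↦ ?_) measurableSet_Ioo
    simp only [smul_eq_mul]
    rw [rpow_add hr.1, ← Nat.cast_pred Module.finrank_pos, rpow_natCast]
    ring
  have hfar : IntegrableOn (fun y : E ↦ B / ‖y‖ ^ p) (ball 0 δ)ᶜ μ := by
    refine integrableOn_const_div_rpow μ measurableSet_ball.compl measurable_norm
      (c := δ / (1 + δ)) B (by positivity) hp fun y hy ↦ ?_
    have : δ ≤ ‖y‖ := by simpa using hy
    rw [div_mul_eq_mul_div, div_le_iff₀ (by positivity)]
    linarith
  have hmeas : Measurable fun y ↦ (f x - f (x + y)) / ‖y‖ ^ p := by fun_prop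
  rw [← integrableOn_univ, ← union_compl_self (ball (0 : E) δ)]
  refine IntegrableOn.union (hnear.mono' hmeas.aestronglyMeasurable ?_)
    (hfar.mono' hmeas.aestronglyMeasurable ?_)
  · filter_upwards [ae_restrict_mem measurableSet_ball] with y hy
    rw [mem_ball_zero_iff] at hy
    rcases eq_or_ne y 0 with rfl | hy0
    · simp only [add_zero, sub_self, zero_div, norm_zero]
      positivity
    · have hpos : 0 < ‖y‖ := norm_pos_iff.2 hy0
      rw [norm_div, norm_eq_abs, norm_of_nonneg (by positivity), rpow_sub hpos, rpow_two,
        ← mul_div_assoc]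
      gcongr
      exact hK y hy
  · filter_upwards with y
    rw [norm_div, norm_eq_abs, norm_of_nonneg (by positivity)]
    gcongr
    exact hB _

end

/-- Lower bound at an interior minimum: if `0 ≤ v ≤ m`, `v = m` on the annulus
`B_{7/8} \ B_{5/8}`, `v` attains its minimum over `closedBall 0 (7/8)` at `x̄ ∈ B_{5/8}`,
and `(-Δ)^s v(x̄) + M v(x̄) ≥ 0`, then `v(x̄) ≥ M₂ m / (M₁ + M₂ + M)`. The fractional
Laplacian is written via the symmetric second-difference formula. -/
theorem min_point_lower_bound_fracLap
    (n : ℕ) (hn : 2 ≤ n) (s : ℝ) (hs : s ∈ Set.Ioo (0:ℝ) 1)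
    (Cns : ℝ) (hCns : 0 < Cns) (M : ℝ) (hM : 0 < M) (m : ℝ)
    (v : EuclideanSpace ℝ (Fin n) → ℝ) (hv : ContDiff ℝ (⊤ : ℕ∞) v)
    (hvrange : ∀ x, v x ∈ Set.Icc (0:ℝ) m)
    (hvann : ∀ x : EuclideanSpace ℝ (Fin n),
      x ∈ ball (0 : EuclideanSpace ℝ (Fin n)) (7/8) \ ball 0 (5/8) → v x = m)
    (xb : EuclideanSpace ℝ (Fin n))
    (hxb : xb ∈ ball (0 : EuclideanSpace ℝ (Fin n)) (5/8))
    (hmin : IsMinOn v (closedBall (0 : EuclideanSpace ℝ (Fin n)) (7/8)) xb)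
    (M1 M2 : ℝ)
    (hM1 : M1 = ∫ y in {y : EuclideanSpace ℝ (Fin n) | 7/8 ≤ ‖y‖},
      Cns / (‖y‖ - 5/8) ^ ((n:ℝ) + 2*s))
    (hM2 : M2 = ∫ y in {y : EuclideanSpace ℝ (Fin n) | 5/8 ≤ ‖y‖ ∧ ‖y‖ ≤ 7/8},
      Cns / ‖y‖ ^ ((n:ℝ) + 2*s))
    (hsuper : 0 ≤ (Cns / 2) *
        (∫ y, (2 * v xb - v (xb + y) - v (xb - y)) / ‖y‖ ^ ((n:ℝ) + 2*s))
      + M * v xb) :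
    M2 / (M1 + M2 + M) * m ≤ v xb := by
  obtain ⟨hs0, hs1⟩ := hs
  have : NeZero n := ⟨by omega⟩
  have hfr : Module.finrank ℝ (EuclideanSpace ℝ (Fin n)) = n := finrank_euclideanSpace_fin
  set p : ℝ := n + 2 * s with hp
  have hpn : (Module.finrank ℝ (EuclideanSpace ℝ (Fin n)) : ℝ) < p := by rw [hfr]; linarith
  have hxn : ‖xb‖ < 5 / 8 := by simpa using hxb
  have hv2 : ContDiff ℝ 2 v := hv.of_le (WithTop.coe_le_coe.2 le_top)
  have hmin' : ∀ z, ‖z‖ < 7 / 8 → v xb ≤ v z := fun z hz ↦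
    hmin (by simpa using hz.le)
  have hcrit : fderiv ℝ v xb = 0 :=
    (hmin.isLocalMin (closedBall_mem_nhds_of_mem (by
      rw [mem_ball_zero_iff]; linarith))).fderiv_eq_zero
  have hint : Integrable fun y ↦ (v xb - v (xb + y)) / ‖y‖ ^ p :=
    integrable_sub_div_rpow_norm volume (B := m) hv2 hcrit
      (fun y ↦ abs_sub_le_iff.2 ⟨by linarith [(hvrange xb).2, (hvrange y).1],
        by linarith [(hvrange xb).1, (hvrange y).2]⟩) hpn (by rw [hfr]; linarith)
  have hsymm : ∫ y, (2 * v xb - v (xb + y) - v (xb - y)) / ‖y‖ ^ p =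
      2 * ∫ y, (v xb - v (xb + y)) / ‖y‖ ^ p := by
    have hneg := integral_neg_eq_self (fun y ↦ (v xb - v (xb + y)) / ‖y‖ ^ p) volume
    rw [two_mul (∫ y, (v xb - v (xb + y)) / ‖y‖ ^ p)]
    nth_rewrite 2 [← hneg]
    rw [← integral_add hint hint.comp_neg]
    congr 1 with y
    rw [norm_neg, ← sub_eq_add_neg, ← add_div]
    congr 1
    ring
  have hA : MeasurableSet {y : EuclideanSpace ℝ (Fin n) | 7 / 8 ≤ ‖y‖} :=
    measurable_norm measurableSet_Ici
  have hR : MeasurableSet {y : EuclideanSpace ℝ (Fin n) | 5 / 8 ≤ ‖y‖ ∧ ‖y‖ < 7 / 8} :=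
    measurable_norm measurableSet_Ico
  have hRx : MeasurableSet
      {y : EuclideanSpace ℝ (Fin n) | 5 / 8 ≤ ‖xb + y‖ ∧ ‖xb + y‖ < 7 / 8} :=
    (by fun_prop : Measurable fun y ↦ ‖xb + y‖) measurableSet_Ico
  have hM1int : IntegrableOn (fun y : EuclideanSpace ℝ (Fin n) ↦ Cns / (‖y‖ - 5 / 8) ^ p)
      {y | 7 / 8 ≤ ‖y‖} :=
    integrableOn_const_div_rpow volume hA (by fun_prop) (c := 2 / 15) Cns (by norm_num) hpn
      fun y hy ↦ by
        have : 7 / 8 ≤ ‖y‖ := hy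
        linarith
  have hRint : IntegrableOn (fun y : EuclideanSpace ℝ (Fin n) ↦ Cns / ‖y‖ ^ p)
      {y | 5 / 8 ≤ ‖y‖ ∧ ‖y‖ < 7 / 8} :=
    integrableOn_const_div_rpow volume hR (by fun_prop) (c := 1 / 3) Cns (by norm_num) hpn
      fun y hy ↦ by linarith [hy.1]
  have hRxint : IntegrableOn (fun y : EuclideanSpace ℝ (Fin n) ↦ Cns / ‖y‖ ^ p)
      {y | 5 / 8 ≤ ‖xb + y‖ ∧ ‖xb + y‖ < 7 / 8} := by
    have hδ : 0 < 5 / 8 - ‖xb‖ := by linarith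
    refine integrableOn_const_div_rpow volume hRx (by fun_prop)
      (c := (5 / 8 - ‖xb‖) / (1 + (5 / 8 - ‖xb‖))) Cns (by positivity) hpn fun y hy ↦ ?_
    have : 5 / 8 - ‖xb‖ ≤ ‖y‖ := by linarith [hy.1, norm_add_le xb y]
    rw [div_mul_eq_mul_div, div_le_iff₀ (by positivity)]
    linarith
  have hM2' : M2 = ∫ y in {y : EuclideanSpace ℝ (Fin n) | 5 / 8 ≤ ‖y‖ ∧ ‖y‖ < 7 / 8},
      Cns / ‖y‖ ^ p := by
    rw [hM2]
    have hne : ∀ᵐ y : EuclideanSpace ℝ (Fin n), y ∉ sphere 0 (7 / 8) :=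
      measure_eq_zero_iff_ae_notMem.1 (Measure.addHaar_sphere volume 0 (7 / 8))
    refine setIntegral_congr_set (Filter.eventuallyEq_set.2 ?_)
    filter_upwards [hne] with y hy
    exact and_congr_right fun _ ↦ ⟨fun h ↦ h.lt_of_ne (by simpa using hy), le_of_lt⟩
  have hM2le : M2 ≤ ∫ y in {y | 5 / 8 ≤ ‖xb + y‖ ∧ ‖xb + y‖ < 7 / 8}, Cns / ‖y‖ ^ p := by
    have hnn : ∀ y : EuclideanSpace ℝ (Fin n), 0 ≤ Cns / ‖y‖ ^ p := fun y ↦ by positivity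
    have hpow : ∀ y : EuclideanSpace ℝ (Fin n), ENNReal.ofReal (Cns / ‖y‖ ^ p) =
        ENNReal.ofReal Cns * ENNReal.ofReal
          (‖y‖ ^ (-(Module.finrank ℝ (EuclideanSpace ℝ (Fin n)) + 2 * s))) := fun y ↦ by
      rw [← ENNReal.ofReal_mul hCns.le, hfr, rpow_neg (norm_nonneg y), div_eq_mul_inv]
    rw [hM2', integral_eq_lintegral_of_nonneg_ae (.of_forall hnn) hRint.aestronglyMeasurable,
      integral_eq_lintegral_of_nonneg_ae (.of_forall hnn) hRxint.aestronglyMeasurable]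
    refine ENNReal.toReal_mono hRxint.lintegral_lt_top.ne ?_
    simp only [hpow]
    rw [lintegral_const_mul _ (by fun_prop), lintegral_const_mul _ (by fun_prop)]
    exact mul_le_mul_right
      (setLIntegral_shell_rpow_norm_le volume hxn (by norm_num) (by positivity)) _
  have hM1nn : 0 ≤ M1 := by
    rw [hM1]
    refine setIntegral_nonneg hA fun y hy ↦ div_nonneg hCns.le (rpow_nonneg ?_ _)
    have : 7 / 8 ≤ ‖y‖ := hy
    linarith
  have hM2nn : 0 ≤ M2 := by
    rw [hM2']
    exact integral_nonneg fun y ↦ by positivity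
  have hbound : Cns * ∫ y, (v xb - v (xb + y)) / ‖y‖ ^ p ≤
      v xb * M1 - (m - v xb) *
        ∫ y in {y | 5 / 8 ≤ ‖xb + y‖ ∧ ‖xb + y‖ < 7 / 8}, Cns / ‖y‖ ^ p := by
    rw [hM1, ← integral_indicator hA, ← integral_indicator hRx,
      ← integral_add_left_eq_self ({y | 7 / 8 ≤ ‖y‖}.indicator _) xb,
      ← integral_const_mul, ← integral_const_mul, ← integral_const_mul, ← integral_sub
        (((hM1int.integrable_indicator hA).comp_add_left xb).const_mul _)
        ((hRxint.integrable_indicator hRx).const_mul _)]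
    refine integral_mono (hint.const_mul _)
      ((((hM1int.integrable_indicator hA).comp_add_left xb).const_mul _).sub
        ((hRxint.integrable_indicator hRx).const_mul _)) fun y ↦ ?_
    simp only [Set.indicator, Set.mem_ofPred_eq]
    have hy0 : 0 ≤ ‖y‖ ^ p := by positivity
    rcases lt_or_ge ‖xb + y‖ (7 / 8) with h7 | h7
    · rw [if_neg h7.not_ge]
      rcases lt_or_ge ‖xb + y‖ (5 / 8) with h5 | h5
      · rw [if_neg fun h ↦ h5.not_ge h.1]
        have := div_nonpos_of_nonpos_of_nonneg (sub_nonpos.2 (hmin' _ h7)) hy0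
        nlinarith
      · rw [if_pos ⟨h5, h7⟩, hvann (xb + y) ⟨by simpa using h7, by simpa using h5⟩]
        apply le_of_eq
        ring
    · rw [if_pos h7, if_neg fun h ↦ h.2.not_ge h7, mul_zero, sub_zero, mul_div_assoc',
        mul_div_assoc', mul_comm (v xb)]
      have hpos : 0 < ‖xb + y‖ - 5 / 8 := by linarith
      have hle : ‖xb + y‖ - 5 / 8 ≤ ‖y‖ := by linarith [norm_add_le xb y]
      have := (hvrange xb).1
      have := (hvrange (xb + y)).1
      gcongr
      linarith
  rw [hsymm] at hsuper
  have hmv : 0 ≤ m - v xb := sub_nonneg.2 (hvrange xb).2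
  rw [div_mul_eq_mul_div, div_le_iff₀ (by positivity)]
  nlinarith [mul_le_mul_of_nonneg_left hM2le hmv]
end
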